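/- arXiv:2603.00651 — 4 statements merged into one kernel-verified Lean document; each statement's English description precedes it below -/
import Mathlib

section
/- Let Y be a nonempty finite index set, let γ > 0 and m > 0 be real numbers, and let a : Y → ℝ satisfy a_y > 0 for all y ∈ Y. Define m*_y = m · a_y^{1/(1+γ)} / Σ_{y'∈Y} a_{y'}^{1/(1+γ)}. Then for every function v : Y → ℝ with v_y > 0 for all y and Σ_{y∈Y} v_y = m, one has Σ_{y∈Y} a_y (m*_y)^{−γ} ≤ Σ_{y∈Y} a_y v_y^{−γ}. -/
/-- **Optimal allocation for the representation error (Theorem 3.3 / A.3, optimality).**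
For `γ > 0`, budget `m > 0` and positive coefficients `a`, the allocation
`mstar y = m * a y ^ (1/(1+γ)) / ∑ y', a y' ^ (1/(1+γ))` minimizes
`∑ y, a y * v y ^ (-γ)` over all positive allocations `v` with `∑ y, v y = m`. -/
theorem optimal_allocation {Y : Type*} [Fintype Y] [Nonempty Y]
    (γ m : ℝ) (hγ : 0 < γ) (hm : 0 < m)
    (a : Y → ℝ) (ha : ∀ y : Y, 0 < a y)
    (mstar : Y → ℝ)
    (hmstar : ∀ y : Y, mstar y =
      m * a y ^ (1 / (1 + γ)) / ∑ y' : Y, a y' ^ (1 / (1 + γ)))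
    (v : Y → ℝ) (hv : ∀ y : Y, 0 < v y) (hvsum : ∑ y : Y, v y = m) :
    ∑ y : Y, a y * mstar y ^ (-γ) ≤ ∑ y : Y, a y * v y ^ (-γ) := by
  have hb : ∀ y, 0 < a y ^ (1 / (1 + γ)) := fun y => Real.rpow_pos_of_pos (ha y) _
  have hS : 0 < ∑ y' : Y, a y' ^ (1 / (1 + γ)) :=
    Finset.sum_pos (fun y _ => hb y) Finset.univ_nonempty
  have hμ : ∀ y, 0 < mstar y := fun y => by
    rw [hmstar]; exact div_pos (mul_pos hm (hb y)) hS
  have hsum : ∑ y, mstar y = m := by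
    simp_rw [hmstar]
    rw [← Finset.sum_div, ← Finset.mul_sum]
    field_simp
  set S := ∑ y' : Y, a y' ^ (1 / (1 + γ)) with hSdef
  have hC : 0 < (S / m) ^ (1 + γ) := Real.rpow_pos_of_pos (div_pos hS hm) _
  set C := (S / m) ^ (1 + γ) with hCdef
  have haC : ∀ y, a y = C * mstar y ^ (1 + γ) := fun y => by
    rw [hCdef, ← Real.mul_rpow (div_pos hS hm).le (hμ y).le, hmstar]
    have h1 : S / m * (m * a y ^ (1 / (1 + γ)) / S) = a y ^ (1 / (1 + γ)) := by
      field_simp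
    rw [h1, ← Real.rpow_mul (ha y).le, one_div_mul_cancel (by positivity), Real.rpow_one]
  have hstar : ∀ y, a y * mstar y ^ (-γ) = C * mstar y := fun y => by
    rw [haC y, mul_assoc, ← Real.rpow_add (hμ y)]
    simp
  have key : ∀ y, C * (mstar y - γ * (v y - mstar y)) ≤ a y * v y ^ (-γ) := fun y => by
    have ht : 0 < v y / mstar y := div_pos (hv y) (hμ y)
    have h1 : 1 - γ * (v y / mstar y - 1) ≤ (v y / mstar y) ^ (-γ) := by
      rw [Real.rpow_def_of_pos ht]
      have h2 := Real.add_one_le_exp (Real.log (v y / mstar y) * -γ)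
      have h3 := mul_le_mul_of_nonneg_left (Real.log_le_sub_one_of_pos ht) hγ.le
      linarith
    have h4 : v y ^ (-γ) = mstar y ^ (-γ) * (v y / mstar y) ^ (-γ) := by
      rw [← Real.mul_rpow (hμ y).le ht.le, mul_div_cancel₀ _ (hμ y).ne']
    rw [h4, ← mul_assoc, hstar]
    have h5 := mul_le_mul_of_nonneg_left h1 (mul_pos hC (hμ y)).le
    refine le_trans (le_of_eq ?_) h5
    have := (hμ y).ne'
    field_simp
  calc ∑ y, a y * mstar y ^ (-γ) = C * m := by
        simp_rw [hstar]; rw [← Finset.mul_sum, hsum]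
    _ = ∑ y, C * (mstar y - γ * (v y - mstar y)) := by
        rw [← Finset.mul_sum, Finset.sum_sub_distrib, ← Finset.mul_sum,
          Finset.sum_sub_distrib, hsum, hvsum]
        ring
    _ ≤ _ := Finset.sum_le_sum fun y _ => key y
end

section
/- Let Y be a nonempty finite index set, let γ > 0 and m > 0 be real numbers, and let a : Y → ℝ satisfy a_y > 0 for all y ∈ Y. Define m*_y = m · a_y^{1/(1+γ)} / Σ_{y'∈Y} a_{y'}^{1/(1+γ)}. If v : Y → ℝ satisfies v_y > 0 for all y, Σ_{y∈Y} v_y = m, and v ≠ m*, then Σ_{y∈Y} a_y v_y^{−γ} > Σ_{y∈Y} a_y (m*_y)^{−γ}. In particular, m* is the unique minimizer of the objective over all feasible allocations. -/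
theorem tangent_aux (γ t : ℝ) (hγ : 0 < γ) (ht : 0 < t) (h1 : t ≠ 1) :
    1 - γ * (t - 1) < t ^ (-γ) := by
  have h2 := Real.log_lt_sub_one_of_pos ht h1
  rw [Real.rpow_def_of_pos ht]
  have h3 := Real.add_one_le_exp (Real.log t * -γ)
  nlinarith [mul_lt_mul_of_pos_left h2 hγ]

/-- **Optimal allocation (Theorem A.3, uniqueness).**
Any positive allocation `v` with `∑ y, v y = m` that differs from
`mstar y = m * a y ^ (1/(1+γ)) / ∑ y', a y' ^ (1/(1+γ))` has strictly larger
objective value `∑ y, a y * v y ^ (-γ)`; hence `mstar` is the unique minimizer. -/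
theorem optimal_allocation_unique {Y : Type*} [Fintype Y] [Nonempty Y]
    (γ m : ℝ) (hγ : 0 < γ) (hm : 0 < m)
    (a : Y → ℝ) (ha : ∀ y : Y, 0 < a y)
    (mstar : Y → ℝ)
    (hmstar : ∀ y : Y, mstar y =
      m * a y ^ (1 / (1 + γ)) / ∑ y' : Y, a y' ^ (1 / (1 + γ)))
    (v : Y → ℝ) (hv : ∀ y : Y, 0 < v y) (hvsum : ∑ y : Y, v y = m)
    (hne : v ≠ mstar) :
    ∑ y : Y, a y * mstar y ^ (-γ) < ∑ y : Y, a y * v y ^ (-γ) := by 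
  set S := ∑ y' : Y, a y' ^ (1 / (1 + γ)) with hS
  have hb : ∀ y, 0 < a y ^ (1 / (1 + γ)) := fun y => Real.rpow_pos_of_pos (ha y) _
  have hSpos : 0 < S := Finset.sum_pos (fun y _ => hb y) Finset.univ_nonempty
  have hk : 0 < m / S := div_pos hm hSpos
  have hM : ∀ y, mstar y = m / S * a y ^ (1 / (1 + γ)) := fun y => by
    rw [hmstar y]; ring
  have hMpos : ∀ y, 0 < mstar y := fun y => by
    rw [hM y]; exact mul_pos hk (hb y)
  have hMsum : ∑ y, mstar y = m := by
    simp_rw [hM]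
    rw [← Finset.mul_sum, ← hS]
    field_simp
  set C := (m / S) ^ (-γ) / (m / S) with hC
  have hCpos : 0 < C := div_pos (Real.rpow_pos_of_pos hk _) hk
  have key : ∀ y, a y * mstar y ^ (-γ) = C * mstar y := fun y => by
    have e : a y * (a y ^ (1 / (1 + γ))) ^ (-γ) = a y ^ (1 / (1 + γ)) := by
      rw [← Real.rpow_mul (ha y).le]
      nth_rewrite 1 [← Real.rpow_one (a y)]
      rw [← Real.rpow_add (ha y)]
      congr 1
      field_simp
      ring
    rw [hM y, Real.mul_rpow hk.le (hb y).le, mul_left_comm, e, hC]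
    rw [← mul_assoc, div_mul_cancel₀ _ hk.ne']
  have split : ∀ y, a y * v y ^ (-γ) = C * mstar y * (v y / mstar y) ^ (-γ) := fun y => by
    rw [← key y, mul_assoc, ← Real.mul_rpow (hMpos y).le (div_pos (hv y) (hMpos y)).le,
      mul_div_cancel₀ _ (hMpos y).ne']
  have lin : ∀ y, C * mstar y * (1 - γ * (v y / mstar y - 1))
      = C * mstar y - C * γ * (v y - mstar y) := fun y => by
    have := (hMpos y).ne'
    field_simp
  have strict : ∀ y, v y ≠ mstar y →
      C * mstar y - C * γ * (v y - mstar y) < a y * v y ^ (-γ) := fun y hy => by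
    rw [split y, ← lin y]
    refine mul_lt_mul_of_pos_left (tangent_aux γ _ hγ (div_pos (hv y) (hMpos y)) ?_)
      (mul_pos hCpos (hMpos y))
    intro h
    exact hy ((div_eq_one_iff_eq (hMpos y).ne').1 h)
  have hsum : ∑ y, a y * mstar y ^ (-γ)
      = ∑ y, (C * mstar y - C * γ * (v y - mstar y)) := by
    simp_rw [key]
    rw [Finset.sum_sub_distrib, ← Finset.mul_sum, ← Finset.mul_sum, Finset.sum_sub_distrib,
      hvsum, hMsum]
    ring
  rw [hsum]
  obtain ⟨y0, hy0⟩ := Function.ne_iff.1 hne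
  refine Finset.sum_lt_sum (fun y _ => ?_) ⟨y0, Finset.mem_univ _, strict y0 hy0⟩
  by_cases h : v y = mstar y
  · rw [h, key y]; simp
  · exact (strict y h).le
end

section
/- Let X be a measurable space and Y a nonempty finite index set. Let π, ρ : Y → ℝ be nonnegative with Σ_{y∈Y} π_y = 1 and Σ_{y∈Y} ρ_y = 1, let (p_y)_{y∈Y} and (q_y)_{y∈Y} be families of probability measures on X, and set p = Σ_{y∈Y} π_y p_y and q = Σ_{y∈Y} ρ_y q_y. Let ℓ : X → ℝ be measurable with |ℓ(x)| ≤ B for all x, for some B ≥ 0. Then |∫ ℓ dp − ∫ ℓ dq| ≤ Σ_{y∈Y} π_y |∫ ℓ dp_y − ∫ ℓ dq_y| + B Σ_{y∈Y} |π_y − ρ_y|. -/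
open MeasureTheory

/-- **Class-wise decomposition inequality (Equation 4).**
For mixtures `p = ∑ y, π y • p y` and `q = ∑ y, ρ y • q y` of probability
measures with priors `π, ρ`, and a measurable loss `ℓ` bounded by `B`,
`|∫ ℓ dp - ∫ ℓ dq| ≤ ∑ y, π y |∫ ℓ dp_y - ∫ ℓ dq_y| + B ∑ y, |π y - ρ y|`,
i.e. representation error plus the prior-mismatch bias `2B‖π - ρ‖_TV`. -/
theorem classwise_decomposition_bound {X : Type*} [MeasurableSpace X]
    {Y : Type*} [Fintype Y] [Nonempty Y]
    (π ρ : Y → ℝ) (hπ0 : ∀ y : Y, 0 ≤ π y) (hρ0 : ∀ y : Y, 0 ≤ ρ y)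
    (hπ1 : ∑ y : Y, π y = 1) (hρ1 : ∑ y : Y, ρ y = 1)
    (p q : Y → Measure X)
    [∀ y : Y, IsProbabilityMeasure (p y)] [∀ y : Y, IsProbabilityMeasure (q y)]
    (B : ℝ) (hB : 0 ≤ B)
    (ℓ : X → ℝ) (hmeas : Measurable ℓ) (hbd : ∀ x : X, |ℓ x| ≤ B) :
    |(∫ x, ℓ x ∂(∑ y : Y, ENNReal.ofReal (π y) • p y)) -
        ∫ x, ℓ x ∂(∑ y : Y, ENNReal.ofReal (ρ y) • q y)| ≤
      (∑ y : Y, π y * |(∫ x, ℓ x ∂(p y)) - ∫ x, ℓ x ∂(q y)|) +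
        B * ∑ y : Y, |π y - ρ y| := by
  have hint : ∀ (μ : Measure X) [IsProbabilityMeasure μ], Integrable ℓ μ := fun μ _ =>
    Integrable.of_bound hmeas.aestronglyMeasurable B (Filter.Eventually.of_forall hbd)
  have key : ∀ (w : Y → ℝ) (m : Y → Measure X) [∀ y, IsProbabilityMeasure (m y)],
      (∀ y, 0 ≤ w y) → ∫ x, ℓ x ∂(∑ y : Y, ENNReal.ofReal (w y) • m y)
        = ∑ y : Y, w y * ∫ x, ℓ x ∂(m y) := by
    intro w m _ hw
    rw [integral_finsetSum_measure
      (fun y _ => (hint (m y)).smul_measure ENNReal.ofReal_ne_top)]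
    refine Finset.sum_congr rfl fun y _ => ?_
    rw [integral_smul_measure, ENNReal.toReal_ofReal (hw y), smul_eq_mul]
  rw [key π p hπ0, key ρ q hρ0, ← Finset.sum_sub_distrib, Finset.mul_sum,
    ← Finset.sum_add_distrib]
  refine (Finset.abs_sum_le_sum_abs _ _).trans (Finset.sum_le_sum fun y _ => ?_)
  have hq : |∫ x, ℓ x ∂(q y)| ≤ B := by
    have h := norm_integral_le_of_norm_le_const (μ := q y) (f := ℓ) (C := B)
      (Filter.Eventually.of_forall hbd)
    simpa using h
  have e : π y * (∫ x, ℓ x ∂(p y)) - ρ y * ∫ x, ℓ x ∂(q y)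
      = π y * ((∫ x, ℓ x ∂(p y)) - ∫ x, ℓ x ∂(q y)) + (∫ x, ℓ x ∂(q y)) * (π y - ρ y) := by
    ring
  rw [e]
  refine (abs_add_le _ _).trans ?_
  rw [abs_mul, abs_mul, abs_of_nonneg (hπ0 y)]
  gcongr
end

section
/- Let X be a measurable space, Y a nonempty finite index set, and Θ a nonempty type. Let π, ρ : Y → ℝ be nonnegative with Σ_{y∈Y} π_y = 1 and Σ_{y∈Y} ρ_y = 1, let (p_y)_{y∈Y} and (q_y)_{y∈Y} be families of probability measures on X, and set p = Σ_{y∈Y} π_y p_y and q = Σ_{y∈Y} ρ_y q_y. Let ℓ : Θ → X → ℝ be such that each ℓ_θ is measurable with |ℓ_θ(x)| ≤ B for all x, for some B ≥ 0. Let ε : Y → ℝ satisfy |∫ ℓ_θ dp_y − ∫ ℓ_θ dq_y| ≤ ε_y for every θ ∈ Θ and y ∈ Y. If θ* minimizes θ ↦ ∫ ℓ_θ dp over Θ and θ̂ minimizes θ ↦ ∫ ℓ_θ dq over Θ, then ∫ ℓ_{θ̂} dp − ∫ ℓ_{θ*} dp ≤ 2 (Σ_{y∈Y} π_y ε_y +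 B Σ_{y∈Y} |π_y − ρ_y|). -/
open MeasureTheory

/-- **Generalization gap via the class-wise decomposition
(Lemma 3.1 + Equation 4).** For mixtures `p = ∑ y, π y • p y` and
`q = ∑ y, ρ y • q y` of probability measures, a uniformly bounded loss family
`ℓ θ`, per-class representation errors `ε y` with
`|∫ ℓ θ dp_y - ∫ ℓ θ dq_y| ≤ ε y` for all `θ`, a minimizer `θstar` of the risk
under `p` and a minimizer `θhat` of the risk under `q`, one has
`∫ ℓ θhat dp - ∫ ℓ θstar dp ≤ 2 (∑ y, π y ε y + B ∑ y, |π y - ρ y|)`. -/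
theorem gen_gap_classwise {X : Type*} [MeasurableSpace X]
    {Y : Type*} [Fintype Y] [Nonempty Y] {Θ : Type*} [Nonempty Θ]
    (π ρ : Y → ℝ) (hπ0 : ∀ y : Y, 0 ≤ π y) (hρ0 : ∀ y : Y, 0 ≤ ρ y)
    (hπ1 : ∑ y : Y, π y = 1) (hρ1 : ∑ y : Y, ρ y = 1)
    (p q : Y → Measure X)
    [∀ y : Y, IsProbabilityMeasure (p y)] [∀ y : Y, IsProbabilityMeasure (q y)]
    (B : ℝ) (hB : 0 ≤ B)
    (ℓ : Θ → X → ℝ) (hmeas : ∀ θ : Θ, Measurable (ℓ θ))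
    (hbd : ∀ θ : Θ, ∀ x : X, |ℓ θ x| ≤ B)
    (ε : Y → ℝ)
    (hε : ∀ θ : Θ, ∀ y : Y, |(∫ x, ℓ θ x ∂(p y)) - ∫ x, ℓ θ x ∂(q y)| ≤ ε y)
    (θstar θhat : Θ)
    (hstar : ∀ θ : Θ, (∫ x, ℓ θstar x ∂(∑ y : Y, ENNReal.ofReal (π y) • p y)) ≤
      ∫ x, ℓ θ x ∂(∑ y : Y, ENNReal.ofReal (π y) • p y))
    (hhat : ∀ θ : Θ, (∫ x, ℓ θhat x ∂(∑ y : Y, ENNReal.ofReal (ρ y) • q y)) ≤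
      ∫ x, ℓ θ x ∂(∑ y : Y, ENNReal.ofReal (ρ y) • q y)) :
    (∫ x, ℓ θhat x ∂(∑ y : Y, ENNReal.ofReal (π y) • p y)) -
        ∫ x, ℓ θstar x ∂(∑ y : Y, ENNReal.ofReal (π y) • p y) ≤
      2 * ((∑ y : Y, π y * ε y) + B * ∑ y : Y, |π y - ρ y|) := by 
  have hint : ∀ (w : Y → ℝ) (m : Y → Measure X), (∀ y, 0 ≤ w y) →
      (∀ y, IsProbabilityMeasure (m y)) → ∀ θ,
      (∫ x, ℓ θ x ∂(∑ y : Y, ENNReal.ofReal (w y) • m y)) = ∑ y, w y * ∫ x, ℓ θ x ∂(m y) := by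
    intro w m hw hm θ
    have hi : ∀ y, Integrable (ℓ θ) (m y) := fun y =>
      Integrable.of_bound (hmeas θ).aestronglyMeasurable B (Filter.Eventually.of_forall (hbd θ))
    rw [integral_finsetSum_measure
      (fun y _ => (hi y).smul_measure ENNReal.ofReal_ne_top)]
    refine Finset.sum_congr rfl fun y _ => ?_
    rw [integral_smul_measure, ENNReal.toReal_ofReal (hw y), smul_eq_mul]
  have key : ∀ θ, |(∫ x, ℓ θ x ∂(∑ y : Y, ENNReal.ofReal (π y) • p y)) -
      ∫ x, ℓ θ x ∂(∑ y : Y, ENNReal.ofReal (ρ y) • q y)| ≤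
      (∑ y : Y, π y * ε y) + B * ∑ y : Y, |π y - ρ y| := by
    intro θ
    rw [hint π p hπ0 inferInstance, hint ρ q hρ0 inferInstance, ← Finset.sum_sub_distrib,
      Finset.mul_sum, ← Finset.sum_add_distrib]
    refine (Finset.abs_sum_le_sum_abs _ _).trans (Finset.sum_le_sum fun y _ => ?_)
    have hq : |∫ x, ℓ θ x ∂(q y)| ≤ B := by
      have := norm_integral_le_of_norm_le_const (μ := q y) (f := ℓ θ) (C := B)
        (Filter.Eventually.of_forall (hbd θ))
      simpa using this
    have e : π y * (∫ x, ℓ θ x ∂(p y)) - ρ y * (∫ x, ℓ θ x ∂(q y)) =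
      π y * ((∫ x, ℓ θ x ∂(p y)) - ∫ x, ℓ θ x ∂(q y)) +
        (∫ x, ℓ θ x ∂(q y)) * (π y - ρ y) := by ring
    rw [e]
    refine (abs_add_le _ _).trans (add_le_add ?_ ?_)
    · rw [abs_mul, abs_of_nonneg (hπ0 y)]
      exact mul_le_mul_of_nonneg_left (hε θ y) (hπ0 y)
    · rw [abs_mul]
      exact mul_le_mul_of_nonneg_right hq (abs_nonneg _)
  have h1 := (abs_le.1 (key θhat)).2
  have h2 := (abs_le.1 (key θstar)).1
  have h3 := hhat θstar
  linarith
end
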